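/- Suppose there exist ε, w ∈ (0,1), a bound δ ∈ ℕ, and infinitely many pairwise disjoint intervals [a_1, b_1), [a_2, b_2), … with a_1 < b_1 ≤ a_2 < b_2 ≤ ⋯, such that each interval [a_i, b_i) is (ε,w)-defected and b_i − a_i ≤ δ. Then for every τ ≥ 0, ‖Φ(t, τ)‖ → 0 as t → ∞ (the TVFJ dynamics is asymptotically stable). -/

import Mathlib

open Matrix Finset Filter

noncomputable section

/-- Maximum absolute row-sum norm of a matrix. -/
noncomputable def rowNorm {n : ℕ} (A : Matrix (Fin n) (Fin n) ℝ) : ℝ :=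
  ⨆ i, ∑ j, |A i j|

/-- Auxiliary product: `PhiAux lam W τ k = Λ(τ+k-1)W(τ+k-1) ⋯ Λ(τ)W(τ)`. -/
noncomputable def PhiAux {n : ℕ} (lam : ℕ → Fin n → ℝ)
    (W : ℕ → Matrix (Fin n) (Fin n) ℝ) (τ : ℕ) : ℕ → Matrix (Fin n) (Fin n) ℝ
  | 0 => 1
  | k + 1 => (Matrix.diagonal (lam (τ + k)) * W (τ + k)) * PhiAux lam W τ k

/-- State-transition matrix `Φ(t,τ) = Λ(t−1)W(t−1) ⋯ Λ(τ)W(τ)`, `Φ(τ,τ) = I`. -/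
noncomputable def Phi {n : ℕ} (lam : ℕ → Fin n → ℝ)
    (W : ℕ → Matrix (Fin n) (Fin n) ℝ) (t τ : ℕ) : Matrix (Fin n) (Fin n) ℝ :=
  PhiAux lam W τ (t - τ)

/-- The interval `[t0, td)` is `(ε,w)`-defected: every agent `i` is reached by an
influential temporal path from an `ε`-stubborn source. -/
def IsDefected {n : ℕ} (lam : ℕ → Fin n → ℝ) (W : ℕ → Matrix (Fin n) (Fin n) ℝ)
    (ε w : ℝ) (t0 td : ℕ) : Prop :=
  ∀ i : Fin n, ∃ τ : ℕ, t0 ≤ τ ∧ τ < td ∧ ∃ a : ℕ → Fin n, a td = i ∧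
    lam τ (a (τ + 1)) ≤ 1 - ε ∧
    ∀ k, τ + 1 ≤ k → k + 1 ≤ td → w ≤ W k (a (k + 1)) (a k)

section TVFJ

variable {n : ℕ} {lam : ℕ → Fin n → ℝ} {W : ℕ → Matrix (Fin n) (Fin n) ℝ}

lemma Phi_self (τ : ℕ) : Phi lam W τ τ = 1 := by
  simp [Phi, PhiAux]

lemma Phi_succ {t τ : ℕ} (h : τ ≤ t) :
    Phi lam W (t + 1) τ = (Matrix.diagonal (lam t) * W t) * Phi lam W t τ := by
  rw [Phi, Nat.succ_sub h, PhiAux, Nat.add_sub_cancel' h, Phi]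

lemma Phi_nonneg (hW0 : ∀ t i j, 0 ≤ W t i j) (hlam0 : ∀ t i, 0 ≤ lam t i)
    {t τ : ℕ} (h : τ ≤ t) (i j : Fin n) : 0 ≤ Phi lam W t τ i j := by
  induction t, h using Nat.le_induction generalizing i with
  | base =>
    rw [Phi_self, Matrix.one_apply]
    split_ifs <;> norm_num
  | succ t h ih =>
    rw [Phi_succ h, Matrix.mul_apply]
    refine Finset.sum_nonneg fun k _ => mul_nonneg ?_ (ih k)
    rw [Matrix.diagonal_mul]
    exact mul_nonneg (hlam0 t i) (hW0 t i k)

/-- The row sums of the state-transition matrix follow the dynamics. -/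
lemma Phi_rowSum_succ {t τ : ℕ} (h : τ ≤ t) (i : Fin n) :
    ∑ j, Phi lam W (t + 1) τ i j = lam t i * ∑ k, W t i k * ∑ j, Phi lam W t τ k j := by
  simp only [Phi_succ h, Matrix.mul_apply (M := Matrix.diagonal (lam t) * W t),
    Matrix.diagonal_mul, Finset.mul_sum]
  rw [Finset.sum_comm]
  simp only [mul_assoc]

/-- A stochastic average of numbers bounded by `M`, one of which (with weight at least `w`) is
bounded by `(1 - c) * M`, is bounded by `(1 - w * c) * M`. -/
lemma sum_mul_le_of_weight {ι : Type*} [Fintype ι] {p y : ι → ℝ} (hp0 : ∀ j, 0 ≤ p j)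
    (hp1 : ∑ j, p j = 1) {M c w : ℝ} (hM : 0 ≤ M) (hc : 0 ≤ c) (hy : ∀ j, y j ≤ M) {k : ι}
    (hk : y k ≤ (1 - c) * M) (hw : w ≤ p k) : ∑ j, p j * y j ≤ (1 - w * c) * M := by
  have hgap : p k * (c * M) ≤ ∑ j, p j * (M - y j) :=
    (mul_le_mul_of_nonneg_left (by linarith) (hp0 k)).trans
      (Finset.single_le_sum (f := fun j => p j * (M - y j))
        (fun j _ => mul_nonneg (hp0 j) (sub_nonneg.2 (hy j))) (Finset.mem_univ k))
  have hsum : ∑ j, p j * (M - y j) = M - ∑ j, p j * y j := by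
    simp only [mul_sub, Finset.sum_sub_distrib, ← Finset.sum_mul, hp1, one_mul]
  have hwp : w * (c * M) ≤ p k * (c * M) := mul_le_mul_of_nonneg_right hw (mul_nonneg hc hM)
  linarith

lemma sum_mul_le_of_le {ι : Type*} [Fintype ι] {p y : ι → ℝ} (hp0 : ∀ j, 0 ≤ p j)
    (hp1 : ∑ j, p j = 1) {M : ℝ} (hy : ∀ j, y j ≤ M) : ∑ j, p j * y j ≤ M :=
  calc ∑ j, p j * y j ≤ ∑ j, p j * M :=
        Finset.sum_le_sum fun j _ => mul_le_mul_of_nonneg_left (hy j) (hp0 j)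
    _ = M := by rw [← Finset.sum_mul, hp1, one_mul]

variable {x : ℕ → Fin n → ℝ} {s : ℕ}

/-- An upper bound on the states is preserved by the dynamics. -/
lemma state_le_of_le (hW0 : ∀ t i j, 0 ≤ W t i j) (hW1 : ∀ t i, ∑ j, W t i j = 1)
    (hlam : ∀ t i, 0 ≤ lam t i ∧ lam t i ≤ 1)
    (hx : ∀ t, s ≤ t → ∀ i, x (t + 1) i = lam t i * ∑ k, W t i k * x t k)
    {M : ℝ} (hM : 0 ≤ M) {t₀ t : ℕ} (hs : s ≤ t₀) (ht : t₀ ≤ t) (h₀ : ∀ i, x t₀ i ≤ M)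
    (i : Fin n) : x t i ≤ M := by
  induction t, ht using Nat.le_induction generalizing i with
  | base => exact h₀ i
  | succ t ht ih =>
    rw [hx t (hs.trans ht)]
    calc lam t i * ∑ k, W t i k * x t k ≤ lam t i * M :=
          mul_le_mul_of_nonneg_left (sum_mul_le_of_le (hW0 t i) (hW1 t i) ih) (hlam t i).1
      _ ≤ M := mul_le_of_le_one_left hM (hlam t i).2

/-- A defected interval of length at most `δ` contracts nonnegative states by the factor
`1 - w ^ δ * ε`. -/
lemma IsDefected.state_le (hW0 : ∀ t i j, 0 ≤ W t i j) (hW1 : ∀ t i, ∑ j, W t i j = 1)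
    (hlam : ∀ t i, 0 ≤ lam t i ∧ lam t i ≤ 1)
    (hx0 : ∀ t, s ≤ t → ∀ i, 0 ≤ x t i)
    (hx : ∀ t, s ≤ t → ∀ i, x (t + 1) i = lam t i * ∑ k, W t i k * x t k)
    {ε w : ℝ} (hε : 0 ≤ ε) (hw0 : 0 ≤ w) (hw1 : w ≤ 1) {t₀ t₁ δ : ℕ} (hδ : t₁ - t₀ ≤ δ)
    (hdef : IsDefected lam W ε w t₀ t₁) (hs : s ≤ t₀)
    {M : ℝ} (hM : 0 ≤ M) (h₀ : ∀ i, x t₀ i ≤ M) (i : Fin n) :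
    x t₁ i ≤ (1 - w ^ δ * ε) * M := by
  obtain ⟨r, hr₀, hr₁, c, rfl, hstub, hpath⟩ := hdef i
  have hbound : ∀ t, t₀ ≤ t → ∀ j, x t j ≤ M := fun t ht =>
    state_le_of_le hW0 hW1 hlam hx hM hs ht h₀
  have key : ∀ m, r + 1 + m ≤ t₁ → x (r + 1 + m) (c (r + 1 + m)) ≤ (1 - w ^ m * ε) * M := by
    intro m
    induction m with
    | zero =>
      intro _
      rw [add_zero, hx r (hs.trans hr₀), pow_zero, one_mul]
      exact (mul_le_mul_of_nonneg_left (sum_mul_le_of_le (hW0 r _) (hW1 r _) (hbound r hr₀))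
        (hlam r _).1).trans (mul_le_mul_of_nonneg_right hstub hM)
    | succ m ih =>
      intro hm
      have hsm : s ≤ r + 1 + m := by omega
      rw [← add_assoc, hx _ hsm, pow_succ', mul_assoc]
      refine (mul_le_of_le_one_left (Finset.sum_nonneg fun k _ =>
        mul_nonneg (hW0 _ _ k) (hx0 _ hsm k)) (hlam _ _).2).trans ?_
      exact sum_mul_le_of_weight (hW0 _ _) (hW1 _ _) hM (by positivity)
        (hbound _ (by omega)) (ih (by omega)) (hpath _ (by omega) (by omega))
  have hend := key (t₁ - (r + 1)) (by omega)
  rw [Nat.add_sub_cancel' hr₁] at hend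
  have hpow : w ^ δ ≤ w ^ (t₁ - (r + 1)) := pow_le_pow_of_le_one hw0 hw1 (by omega)
  refine hend.trans (mul_le_mul_of_nonneg_right ?_ hM)
  linarith [mul_le_mul_of_nonneg_right hpow hε]

end TVFJ

/-- infinitely many pairwise disjoint, uniformly bounded defected
intervals imply asymptotic stability of the TVFJ dynamics. -/
theorem tvfj_asymptotic_stability_of_DTGs {n : ℕ} (hn : 1 ≤ n)
    (lam : ℕ → Fin n → ℝ) (W : ℕ → Matrix (Fin n) (Fin n) ℝ)
    (hW0 : ∀ t i j, 0 ≤ W t i j) (hW1 : ∀ t i, ∑ j, W t i j = 1)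
    (hlam : ∀ t i, 0 ≤ lam t i ∧ lam t i ≤ 1)
    (ε w : ℝ) (hε : 0 < ε ∧ ε < 1) (hw : 0 < w ∧ w < 1)
    (δ : ℕ) (a b : ℕ → ℕ)
    (hab : ∀ i, a i < b i) (hord : ∀ i, b i ≤ a (i + 1))
    (hlen : ∀ i, b i - a i ≤ δ)
    (hdef : ∀ i, IsDefected lam W ε w (a i) (b i)) :
    ∀ τ : ℕ, Filter.Tendsto (fun t => rowNorm (Phi lam W t τ)) Filter.atTop (nhds 0) := by
  intro τ
  have hnonneg : ∀ t, τ ≤ t → ∀ i j, 0 ≤ Phi lam W t τ i j := fun t ht =>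
    Phi_nonneg hW0 (fun t i => (hlam t i).1) ht
  have hx0 : ∀ t, τ ≤ t → ∀ i, 0 ≤ ∑ j, Phi lam W t τ i j := fun t ht i =>
    Finset.sum_nonneg fun j _ => hnonneg t ht i j
  have hx : ∀ t, τ ≤ t → ∀ i, ∑ j, Phi lam W (t + 1) τ i j =
      lam t i * ∑ k, W t i k * ∑ j, Phi lam W t τ k j := fun t ht i => Phi_rowSum_succ ht i
  have ha : StrictMono a := strictMono_nat_of_lt_succ fun i => (hab i).trans_le (hord i)
  have hτa : ∀ k, τ ≤ a (τ + k) := fun k => (Nat.le_add_right τ k).trans (ha.le_apply)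
  set q : ℝ := 1 - w ^ δ * ε
  have hwδ : 0 < w ^ δ := pow_pos hw.1 δ
  have hwδ1 : w ^ δ ≤ 1 := pow_le_one₀ hw.1.le hw.2.le
  have hq0 : 0 ≤ q := by nlinarith
  have hq1 : q < 1 := by nlinarith
  have hstart : ∀ k i, ∑ j, Phi lam W (a (τ + k)) τ i j ≤ q ^ k := by
    intro k
    induction k with
    | zero =>
      refine state_le_of_le (x := fun t i => ∑ j, Phi lam W t τ i j) hW0 hW1 hlam hx
        (by simp) le_rfl (hτa 0) fun i => ?_
      simp [Phi_self, Matrix.one_apply]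
    | succ k ih =>
      have hk : τ ≤ b (τ + k) := (hτa k).trans (hab _).le
      refine state_le_of_le (x := fun t i => ∑ j, Phi lam W t τ i j) hW0 hW1 hlam hx
        (by positivity) hk (hord (τ + k)) fun i => ?_
      rw [pow_succ']
      exact (hdef (τ + k)).state_le (x := fun t i => ∑ j, Phi lam W t τ i j) hW0 hW1 hlam hx0 hx
        hε.1.le hw.1.le hw.2.le (hlen _) (hτa k) (by positivity) ih i
  have : Nonempty (Fin n) := ⟨⟨0, hn⟩⟩
  rw [Metric.tendsto_atTop]
  intro η hη
  obtain ⟨k, hk⟩ := exists_pow_lt_of_lt_one hη hq1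
  refine ⟨a (τ + k), fun t ht => ?_⟩
  have hnorm : rowNorm (Phi lam W t τ) ≤ q ^ k := by
    refine ciSup_le fun i => ?_
    simp only [abs_of_nonneg (hnonneg t ((hτa k).trans ht) i _)]
    exact state_le_of_le (x := fun t i => ∑ j, Phi lam W t τ i j) hW0 hW1 hlam hx
      (by positivity) (hτa k) ht (hstart k) i
  have hnorm0 : 0 ≤ rowNorm (Phi lam W t τ) :=
    Real.iSup_nonneg fun i => Finset.sum_nonneg fun j _ => abs_nonneg _
  rw [Real.dist_eq, sub_zero, abs_of_nonneg hnorm0]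
  exact hnorm.trans_lt hk
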